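/- Fix n₀ ∈ ℕ and permutations π, π′ of Fin (n₀+1). Let D(π,n,k) be the number of permutations σ of Fin (n+1) with exactly k rises whose pattern on the values {0,…,n₀} equals π. Then D(π,n,k)/D(π′,n,k) → 1 as k and n−k both tend to infinity: for every ε > 0 there exists N such that for all n and all k ≤ n with k ≥ N and n−k ≥ N, one has D(π′,n,k) > 0 and |D(π,n,k)/D(π′,n,k) − 1| < ε. -/

import Mathlib

/-- Number of rises of a list: indices `i` with `l[i] < l[i+1]`. -/
def listRises (l : List ℕ) : ℕ :=
  ((l.zip l.tail).filter fun p => p.1 < p.2).length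

/-- Number of rises of a permutation of `Fin m`, viewed as the sequence
`σ 0, σ 1, …, σ (m-1)`. -/
def permRises {m : ℕ} (σ : Equiv.Perm (Fin m)) : ℕ :=
  listRises (List.ofFn fun i => (σ i : ℕ))

/-- The Eulerian number `A(n,k)`: the number of permutations of `Fin (n+1)`
with exactly `k` rises. -/
def eulerian (n k : ℕ) : ℕ :=
  (Finset.univ.filter fun σ : Equiv.Perm (Fin (n+1)) => permRises σ = k).card
/-- The subsequence of `σ 0, …, σ (m-1)` consisting of the entries `< j`. -/
def patternList {m : ℕ} (σ : Equiv.Perm (Fin m)) (j : ℕ) : List ℕ :=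
  (List.ofFn fun i => (σ i : ℕ)).filter (· < j)

/-- `IsPattern σ π` says that the pattern of `σ` on the values `{0, …, m₀-1}`
is the permutation `π` of `Fin m₀`. -/
def IsPattern {m m₀ : ℕ} (σ : Equiv.Perm (Fin m)) (π : Equiv.Perm (Fin m₀)) : Prop :=
  patternList σ m₀ = List.ofFn fun j => (π j : ℕ)

instance {m m₀ : ℕ} (σ : Equiv.Perm (Fin m)) (π : Equiv.Perm (Fin m₀)) :
    Decidable (IsPattern σ π) := by
  unfold IsPattern; infer_instance

/-- `D n₀ π n k`: the number of permutations `σ` of `Fin (n+1)` with exactly `k` rises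
whose pattern on the values `{0,…,n₀}` equals `π`. -/
def D (n₀ : ℕ) (π : Equiv.Perm (Fin (n₀ + 1))) (n k : ℕ) : ℕ :=
  (Finset.univ.filter fun σ : Equiv.Perm (Fin (n + 1)) =>
    permRises σ = k ∧ IsPattern σ π).card

/-- Solution of the Eulerian recurrence started at level `m` from the unit mass at `r`. -/
def eulF (m : ℕ) (r : ℤ) : ℕ → ℤ → ℤ
  | 0, k => if k = r then 1 else 0
  | d + 1, k => (k + 1) * eulF m r d k + ((m : ℤ) + d - k + 2) * eulF m r d (k - 1)

theorem eulF_diff (m : ℕ) (r : ℤ) (d : ℕ) : ∀ k : ℤ,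
    eulF (m + 1) (r + 1) d k - eulF (m + 1) r d k = eulF m r d (k - 1) - eulF m r d k := by
  induction d with
  | zero =>
    intro k
    simp only [eulF, sub_eq_iff_eq_add]
  | succ d ih =>
    intro k
    have h1 := ih k
    have h2 := ih (k - 1)
    simp only [eulF]
    push_cast
    linear_combination (k + 1) * h1 + ((m : ℤ) + 1 + d - k + 2) * h2

theorem eulF_split (m : ℕ) (s : ℤ) (d : ℕ) : ∀ k : ℤ,
    eulF m s (d + 1) k =
      (s + 1) * eulF (m + 1) s d k + (m + 1 - s) * eulF (m + 1) (s + 1) d k := by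
  induction d with
  | zero =>
    intro k
    simp only [eulF, sub_eq_iff_eq_add]
    split_ifs <;> grind
  | succ d ih =>
    intro k
    have h1 := ih k
    have h2 := ih (k - 1)
    rw [eulF, h1, h2]
    simp only [eulF]
    push_cast
    ring

theorem eulF_supp (m : ℕ) (r : ℤ) (h0 : 0 ≤ r) (hm : r ≤ m) (d : ℕ) : ∀ k : ℤ,
    (k < 0 ∨ (m : ℤ) + d < k) → eulF m r d k = 0 := by
  induction d with
  | zero =>
    intro k hk
    have : k ≠ r := by push_cast at hk; omega
    simp [eulF, this]
  | succ d ih =>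
    intro k hk
    push_cast at hk
    rw [eulF, ih k (by omega), ih (k - 1) (by omega)]
    ring

theorem eulF_nonneg (m : ℕ) (r : ℤ) (h0 : 0 ≤ r) (hm : r ≤ m) (d : ℕ) : ∀ k : ℤ,
    0 ≤ eulF m r d k := by
  induction d with
  | zero =>
    intro k
    simp only [eulF]
    split_ifs <;> norm_num
  | succ d ih =>
    intro k
    by_cases hk : k < 0 ∨ (m : ℤ) + (d + 1 : ℕ) < k
    · rw [eulF_supp m r h0 hm _ k hk]
    · push_cast at hk
      rw [eulF]
      have := mul_nonneg (show 0 ≤ k + 1 by omega) (ih k)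
      have := mul_nonneg (show 0 ≤ (m : ℤ) + d - k + 2 by omega) (ih (k - 1))
      omega

theorem eulF_pos (m : ℕ) (r : ℤ) (h0 : 0 ≤ r) (hm : r ≤ m) (d : ℕ) : ∀ k : ℤ,
    r ≤ k → m - r ≤ (m : ℤ) + d - k → 0 < eulF m r d k := by
  induction d with
  | zero =>
    intro k h1 h2
    have : k = r := by push_cast at h2; omega
    simp [eulF, this]
  | succ d ih =>
    intro k h1 h2
    push_cast at h2
    rw [eulF]
    have n1 := mul_nonneg (show 0 ≤ k + 1 by omega) (eulF_nonneg m r h0 hm d k)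
    have n2 := mul_nonneg (show 0 ≤ (m : ℤ) + d - k + 2 by omega) (eulF_nonneg m r h0 hm d (k - 1))
    by_cases h : (m : ℤ) - r ≤ m + d - k
    · have := mul_pos (show 0 < k + 1 by omega) (ih k h1 h)
      omega
    · have := mul_pos (show 0 < (m : ℤ) + d - k + 2 by omega)
        (ih (k - 1) (by omega) (by omega))
      omega

/-- One step estimate. -/
theorem eulF_step (m : ℕ) (s : ℤ) (h0 : 0 ≤ s) (hm : s ≤ m) (d : ℕ) (k N : ℤ)
    (hN : 0 ≤ N) (hk : N ≤ k) (hk' : N ≤ (m : ℤ) + 1 + d - k) :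
    N * |eulF (m + 1) (s + 1) d k - eulF (m + 1) s d k| ≤
      (m + 1) * (eulF (m + 1) s d k + eulF (m + 1) (s + 1) d k) := by
  have a0 := eulF_nonneg (m + 1) (s + 1) (by omega) (by push_cast; omega) d k
  have b0 := eulF_nonneg (m + 1) s (by omega) (by push_cast; omega) d k
  have p0 := eulF_nonneg m s h0 hm d k
  have q0 := eulF_nonneg m s h0 hm d (k - 1)
  have hs := eulF_split m s d k
  rw [eulF] at hs
  rw [eulF_diff]
  have key : |eulF m s d (k - 1) - eulF m s d k| ≤ eulF m s d (k - 1) + eulF m s d k := by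
    rw [abs_le]; constructor <;> omega
  generalize eulF (m + 1) (s + 1) d k = a at *
  generalize eulF (m + 1) s d k = b at *
  generalize eulF m s d (k - 1) = q at *
  generalize eulF m s d k = p at *
  have e1 := mul_le_mul_of_nonneg_left key hN
  have e2 := mul_le_mul_of_nonneg_right (show N ≤ k + 1 by omega) p0
  have e3 := mul_le_mul_of_nonneg_right (show N ≤ (m : ℤ) + d - k + 2 by omega) q0
  have e4 := mul_le_mul_of_nonneg_right (show s + 1 ≤ (m : ℤ) + 1 by omega) b0
  have e5 := mul_le_mul_of_nonneg_right (show (m : ℤ) + 1 - s ≤ (m : ℤ) + 1 by omega) a0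
  linarith

theorem eulF_total (m : ℕ) (d : ℕ) (k N : ℤ)
    (hN : 0 ≤ N) (hk : N ≤ k) (hk' : N ≤ (m : ℤ) + 1 + d - k) (i j : ℕ)
    (hij : i ≤ j) (hj : j ≤ m + 1) :
    N * |eulF (m + 1) j d k - eulF (m + 1) i d k| ≤
      2 * (m + 1) * (m + 2) * ∑ t ∈ Finset.range (m + 2), eulF (m + 1) t d k := by
  have nn : ∀ t ∈ Finset.range (m + 2), 0 ≤ eulF (m + 1) (t : ℤ) d k := by
    intro t ht
    rw [Finset.mem_range] at ht
    exact eulF_nonneg _ _ (by omega) (by push_cast; omega) _ _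
  have sl : ∀ t < m + 2, eulF (m + 1) (t : ℤ) d k ≤
      ∑ t ∈ Finset.range (m + 2), eulF (m + 1) t d k := fun t ht =>
    Finset.single_le_sum (f := fun t : ℕ => eulF (m + 1) (t : ℤ) d k) nn (Finset.mem_range.2 ht)
  have T0 := Finset.sum_nonneg nn
  set T := ∑ t ∈ Finset.range (m + 2), eulF (m + 1) (t : ℤ) d k with hT
  have main : ∀ e : ℕ, i + e ≤ m + 1 →
      N * |eulF (m + 1) (i + e : ℕ) d k - eulF (m + 1) i d k| ≤ e * (2 * (m + 1) * T) := by
    intro e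
    induction e with
    | zero => intro _; simp
    | succ e ih =>
      intro he
      have h1 := ih (by omega)
      have h2 := eulF_step m (i + e : ℕ) (by omega) (by push_cast; omega) d k N hN hk hk'
      have h3 := sl (i + e) (by omega)
      have h4 := sl (i + e + 1) (by omega)
      have h5 := abs_sub_le (eulF (m + 1) (i + e + 1 : ℕ) d k) (eulF (m + 1) (i + e : ℕ) d k)
        (eulF (m + 1) i d k)
      have h6 := mul_le_mul_of_nonneg_left h5 hN
      have h7 : eulF (m + 1) (i + e : ℕ) d k + eulF (m + 1) (i + e + 1 : ℕ) d k ≤ 2 * T := by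
        linarith
      have h8 := mul_le_mul_of_nonneg_left h7 (show (0 : ℤ) ≤ m + 1 by omega)
      have h9 : (((i + e : ℕ) : ℤ) + 1) = ((i + e + 1 : ℕ) : ℤ) := by push_cast; ring
      rw [h9] at h2
      rw [show i + (e + 1) = i + e + 1 by omega]
      push_cast at *
      linarith
  obtain ⟨e, rfl⟩ := Nat.exists_eq_add_of_le hij
  refine (main e hj).trans ?_
  have := mul_le_mul_of_nonneg_right (show (e : ℤ) ≤ m + 2 by omega)
    (show 0 ≤ 2 * ((m : ℤ) + 1) * T by positivity)
  linarith

theorem eulF_total' (m : ℕ) (d : ℕ) (k N : ℤ)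
    (hN : 0 ≤ N) (hk : N ≤ k) (hk' : N ≤ (m : ℤ) + 1 + d - k) (i j : ℕ)
    (hi : i ≤ m + 1) (hj : j ≤ m + 1) :
    N * |eulF (m + 1) j d k - eulF (m + 1) i d k| ≤
      2 * (m + 1) * (m + 2) * ∑ t ∈ Finset.range (m + 2), eulF (m + 1) t d k := by
  rcases le_total i j with h | h
  · exact eulF_total m d k N hN hk hk' i j h hj
  · rw [abs_sub_comm]
    exact eulF_total m d k N hN hk hk' j i h hi

/-- Final estimate: with `C = 2 (m+1) (m+2)` and `N ≥ 2 C (m+2)`. -/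
theorem eulF_final (m : ℕ) (d : ℕ) (k N : ℤ)
    (hN : 4 * (m + 1) * (m + 2) * (m + 2) ≤ N) (hk : N ≤ k) (hk' : N ≤ (m : ℤ) + 1 + d - k)
    (i j : ℕ) (hi : i ≤ m + 1) (hj : j ≤ m + 1) :
    N * |eulF (m + 1) j d k - eulF (m + 1) i d k| ≤
      4 * (m + 1) * (m + 2) * (m + 2) * eulF (m + 1) i d k := by
  have N0 : 0 < N := lt_of_lt_of_le (by positivity) hN
  have nn : ∀ t ∈ Finset.range (m + 2), 0 ≤ eulF (m + 1) (t : ℤ) d k := by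
    intro t ht
    rw [Finset.mem_range] at ht
    exact eulF_nonneg _ _ (by omega) (by push_cast; omega) _ _
  have T0 := Finset.sum_nonneg nn
  have h := eulF_total' m d k N N0.le hk hk' i j hi hj
  have hT : N * ∑ t ∈ Finset.range (m + 2), eulF (m + 1) t d k ≤
      ∑ t ∈ Finset.range (m + 2), (N * eulF (m + 1) i d k +
        2 * (m + 1) * (m + 2) * ∑ t ∈ Finset.range (m + 2), eulF (m + 1) t d k) := by
    rw [Finset.mul_sum]
    refine Finset.sum_le_sum fun t ht => ?_
    rw [Finset.mem_range] at ht
    have h1 := eulF_total' m d k N N0.le hk hk' i t hi (by omega)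
    have h2 := mul_le_mul_of_nonneg_left (le_abs_self
      (eulF (m + 1) t d k - eulF (m + 1) i d k)) N0.le
    linarith
  rw [Finset.sum_const, Finset.card_range, nsmul_eq_mul] at hT
  set T := ∑ t ∈ Finset.range (m + 2), eulF (m + 1) (t : ℤ) d k with hTd
  push_cast at hT
  have h3 := mul_le_mul_of_nonneg_right hN T0
  have h4 : N * T ≤ N * (2 * (m + 2) * eulF (m + 1) i d k) := by linarith
  have h5 := le_of_mul_le_mul_left h4 N0
  have h6 := mul_le_mul_of_nonneg_left h5 (show (0 : ℤ) ≤ 2 * (m + 1) * (m + 2) by positivity)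
  linarith

/-! ### Combinatorial part -/

theorem listRises_cons_cons (a b : ℕ) (l : List ℕ) :
    listRises (a :: b :: l) = (if a < b then 1 else 0) + listRises (b :: l) := by
  by_cases h : a < b <;> simp [listRises, h, add_comm]

theorem listRises_singleton (a : ℕ) : listRises [a] = 0 := by simp [listRises]

theorem listRises_lt (a : ℕ) (l : List ℕ) : listRises (a :: l) ≤ l.length := by
  unfold listRises
  refine (List.length_filter_le _ _).trans ?_
  simp

theorem sum_insert_aux (M : ℕ) (ys : List ℕ) : ∀ (y : ℕ) (g : ℕ → ℤ), y < M → (∀ z ∈ ys, z < M) →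
    ((List.permutations'Aux M ys).map fun l => g (listRises (y :: l))).sum =
      (listRises (y :: ys) : ℤ) * g (listRises (y :: ys)) +
        ((ys.length : ℤ) + 1 - listRises (y :: ys)) * g (listRises (y :: ys) + 1) := by
  induction ys with
  | nil =>
    intro y g hy _
    simp [listRises_cons_cons, listRises_singleton, hy]
  | cons z zs ih =>
    intro y g hy hz
    have hzM : z < M := hz z (by simp)
    have e := ih z (fun r => g ((if y < z then 1 else 0) + r)) hzM
      (fun w hw => hz w (by simp [hw]))
    simp only [List.permutations'Aux, List.map_cons, List.sum_cons, List.map_map,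
      Function.comp_def, listRises_cons_cons, hy, if_true, not_lt.2 hzM.le, if_false] at e ⊢
    rw [e]
    by_cases h : y < z
    · simp only [h, if_true, List.length_cons]
      rw [show 1 + (listRises (z :: zs) + 1) = 1 + listRises (z :: zs) + 1 by ring]
      push_cast
      rw [zero_add]
      ring
    · simp only [h, if_false, List.length_cons, zero_add]
      rw [add_comm 1 (listRises (z :: zs))]
      push_cast
      ring

theorem sum_insert (M : ℕ) (l : List ℕ) (hl : l ≠ []) (g : ℕ → ℤ) (h : ∀ z ∈ l, z < M) :
    ((List.permutations'Aux M l).map fun l => g (listRises l)).sum =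
      ((listRises l : ℤ) + 1) * g (listRises l) +
        ((l.length : ℤ) - listRises l) * g (listRises l + 1) := by
  cases l with
  | nil => exact absurd rfl hl
  | cons y ys =>
    have hy : y < M := h y (by simp)
    have := sum_insert_aux M ys y g hy (fun z hz => h z (by simp [hz]))
    simp only [List.permutations'Aux, List.map_cons, List.sum_cons, List.map_map,
      Function.comp_def, listRises_cons_cons, not_lt.2 hy.le, if_false, zero_add]
    rw [this, List.length_cons]
    push_cast
    ring

theorem filter_insert (M j : ℕ) (hj : j ≤ M) (l : List ℕ) :
    ∀ l' ∈ List.permutations'Aux M l, l'.filter (· < j) = l.filter (· < j) := by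
  induction l with
  | nil => intro l' h; simp [List.permutations'Aux] at h; subst h; simp [hj]
  | cons y ys ih =>
    intro l' h
    simp only [List.permutations'Aux, List.mem_cons, List.mem_map] at h
    rcases h with rfl | ⟨a, ha, rfl⟩
    · rw [List.filter_cons]; simp [hj]
    · rw [List.filter_cons, List.filter_cons, ih a ha]

/-- The list `n-1, …, 0`. -/
def downRange : ℕ → List ℕ
  | 0 => []
  | n + 1 => n :: downRange n

theorem mem_downRange (n a : ℕ) : a ∈ downRange n ↔ a < n := by
  induction n with
  | zero => simp [downRange]
  | succ n ih => simp [downRange, ih]; omega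

theorem nodup_downRange (n : ℕ) : (downRange n).Nodup := by
  induction n with
  | zero => simp [downRange]
  | succ n ih => simp [downRange, ih, mem_downRange]

theorem length_downRange (n : ℕ) : (downRange n).length = n := by
  induction n with
  | zero => simp [downRange]
  | succ n ih => simp [downRange, ih]

theorem sum_perm_eq (m : ℕ) (h : List ℕ → ℤ) :
    ∑ σ : Equiv.Perm (Fin m), h (List.ofFn fun i => (σ i : ℕ)) =
      ((downRange m).permutations'.map h).sum := by
  have nd : (downRange m).permutations'.Nodup :=
    (List.permutations_perm_permutations' _).nodup_iff.1
      (List.nodup_permutations _ (nodup_downRange m))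
  rw [← List.sum_toFinset h nd]
  refine Finset.sum_bij (fun σ _ => List.ofFn fun i => (σ i : ℕ)) ?_ ?_ ?_ ?_
  · intro σ _
    rw [List.mem_toFinset, List.mem_permutations']
    rw [List.perm_ext_iff_of_nodup _ (nodup_downRange m)]
    · intro a
      rw [mem_downRange, List.mem_ofFn]
      constructor
      · rintro ⟨i, rfl⟩; exact (σ i).2
      · intro ha; exact ⟨σ.symm ⟨a, ha⟩, by simp⟩
    · rw [List.nodup_ofFn]
      intro i j hij
      exact σ.injective (Fin.ext hij)
  · intro σ _ τ _ hst
    have := List.ofFn_injective hst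
    ext i
    exact congrFun this i
  · intro l hl
    rw [List.mem_toFinset, List.mem_permutations'] at hl
    have hlen : l.length = m := hl.length_eq.trans (length_downRange m)
    have hnd : l.Nodup := hl.nodup_iff.2 (nodup_downRange m)
    have hlt : ∀ i : Fin m, l[i.1]'(by omega) < m := fun i =>
      (mem_downRange m _).1 (hl.mem_iff.1 (List.getElem_mem _))
    have inj : Function.Injective (fun i : Fin m => (⟨l[i.1]'(by omega), hlt i⟩ : Fin m)) := by
      intro i j hij
      have := congrArg Fin.val hij
      exact Fin.ext ((hnd.getElem_inj_iff).1 this)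
    refine ⟨Equiv.ofBijective _ (Finite.injective_iff_bijective.1 inj), Finset.mem_univ _, ?_⟩
    apply List.ext_getElem
    · simp [hlen]
    · intro i h1 h2
      simp
  · intro _ _; rfl

/-- Weighted count. -/
def wsum (j : ℕ) (p : List ℕ) (n : ℕ) (g : ℕ → ℤ) : ℤ :=
  ((downRange (n + 1)).permutations'.map fun l =>
    if l.filter (· < j) = p then g (listRises l) else 0).sum

theorem sum_flatMap (L : List (List ℕ)) (f : List ℕ → List (List ℕ)) (h : List ℕ → ℤ) :
    ((L.flatMap f).map h).sum = (L.map fun l => ((f l).map h).sum).sum := by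
  induction L with
  | nil => simp
  | cons a L ih => simp [ih]

theorem wsum_succ (j : ℕ) (p : List ℕ) (n : ℕ) (hj : j ≤ n + 1) (g : ℕ → ℤ) :
    wsum j p (n + 1) g = wsum j p n fun r => ((r : ℤ) + 1) * g r + ((n : ℤ) + 1 - r) * g (r + 1) := by
  unfold wsum
  rw [downRange, List.permutations', sum_flatMap]
  congr 1
  apply List.map_congr_left
  intro l hl
  rw [List.mem_permutations'] at hl
  have hlen : l.length = n + 1 := hl.length_eq.trans (length_downRange _)
  have hlt : ∀ z ∈ l, z < n + 1 := fun z hz => (mem_downRange _ _).1 (hl.mem_iff.1 hz)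
  have e : ∀ l' ∈ List.permutations'Aux (n + 1) l,
      (if l'.filter (· < j) = p then g (listRises l') else 0) =
      (if l.filter (· < j) = p then g (listRises l') else 0) := by
    intro l' hl'
    rw [filter_insert (n + 1) j hj l l' hl']
  rw [List.map_congr_left e]
  by_cases hp : l.filter (· < j) = p
  · simp only [hp, if_true]
    rw [sum_insert (n + 1) l (by intro h; simp [h] at hlen) g hlt, hlen]
    push_cast
    ring
  · simp [hp]

theorem wsum_lin (j : ℕ) (p : List ℕ) (n : ℕ) (a b : ℤ) (g h : ℕ → ℤ) :
    wsum j p n (fun r => a * g r + b * h r) = a * wsum j p n g + b * wsum j p n h := by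
  unfold wsum
  induction (downRange (n + 1)).permutations' with
  | nil => simp
  | cons l L ih =>
    simp only [List.map_cons, List.sum_cons, ih]
    split_ifs <;> ring

theorem wsum_eq_eulF (n₀ : ℕ) (π : Equiv.Perm (Fin (n₀ + 1))) (d : ℕ) : ∀ k : ℤ,
    wsum (n₀ + 1) (List.ofFn fun i => (π i : ℕ)) (n₀ + d) (fun r => if (r : ℤ) = k then 1 else 0) =
      eulF n₀ (permRises π) d k := by
  induction d with
  | zero =>
    intro k
    unfold wsum
    rw [add_zero, ← sum_perm_eq]
    rw [Finset.sum_eq_single π]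
    · rw [if_pos]
      · simp [eulF, permRises, eq_comm]
      · rw [List.filter_eq_self]
        intro a ha
        rw [List.mem_ofFn] at ha
        obtain ⟨i, rfl⟩ := ha
        simp only [decide_eq_true_eq]
        exact (π i).2
    · intro σ _ hσ
      rw [if_neg]
      intro h
      rw [List.filter_eq_self.2] at h
      · apply hσ
        have := List.ofFn_injective h
        ext i
        exact congrFun this i
      · intro a ha
        rw [List.mem_ofFn] at ha
        obtain ⟨i, rfl⟩ := ha
        simp only [decide_eq_true_eq]
        exact (σ i).2
    · simp
  | succ d ih =>
    intro k
    rw [← add_assoc, wsum_succ _ _ _ (by omega), eulF, ← ih k, ← ih (k - 1), ← wsum_lin]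
    congr 1
    funext r
    push_cast
    simp only [eq_sub_iff_add_eq]
    split_ifs <;> grind

theorem D_eq_eulF (n₀ : ℕ) (π : Equiv.Perm (Fin (n₀ + 1))) (d k : ℕ) :
    (D n₀ π (n₀ + d) k : ℤ) = eulF n₀ (permRises π) d k := by
  rw [← wsum_eq_eulF, wsum, ← sum_perm_eq, D, Finset.card_filter]
  push_cast
  refine Finset.sum_congr rfl fun σ _ => ?_
  unfold IsPattern patternList permRises
  simp only [Nat.cast_inj]
  split_ifs <;> tauto

theorem permRises_le (n₀ : ℕ) (π : Equiv.Perm (Fin (n₀ + 1))) : permRises π ≤ n₀ := by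
  unfold permRises
  rw [List.ofFn_succ]
  refine (listRises_lt _ _).trans ?_
  simp

/-- For fixed permutations `π, π'` of `Fin (n₀+1)`, the ratio `D(π,n,k)/D(π',n,k)`
tends to `1` as `k` and `n-k` both tend to infinity. -/
theorem dimension_ratio_tendsto_one (n₀ : ℕ) (π π' : Equiv.Perm (Fin (n₀ + 1))) :
    ∀ ε : ℝ, 0 < ε → ∃ N : ℕ, ∀ n k : ℕ, k ≤ n → N ≤ k → N ≤ n - k →
      0 < D n₀ π' n k ∧ |(D n₀ π n k : ℝ) / (D n₀ π' n k : ℝ) - 1| < ε := by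
  intro ε hε
  have hr := permRises_le n₀ π
  have hr' := permRises_le n₀ π'
  have pos : ∀ d k : ℕ, n₀ ≤ k → k ≤ d → 0 < D n₀ π' (n₀ + d) k := by
    intro d k h1 h2
    have := eulF_pos n₀ (permRises π') (by omega) (by omega) d k (by omega) (by omega)
    rw [← D_eq_eulF] at this
    exact_mod_cast this
  cases n₀ with
  | zero =>
    refine ⟨0, fun n k hkn _ _ => ?_⟩
    have hp := pos n k (by omega) hkn
    rw [zero_add] at hp
    have : π = π' := by
      ext i
      have h1 := (π i).2
      have h2 := (π' i).2
      omega
    subst this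
    refine ⟨hp, ?_⟩
    rw [div_self (by positivity)]
    simpa using hε
  | succ m =>
    obtain ⟨N1, hN1⟩ := exists_nat_gt ((4 * (m + 1) * (m + 2) * (m + 2) : ℝ) / ε)
    refine ⟨max N1 (4 * (m + 1) * (m + 2) * (m + 2)), fun n k hkn h1 h2 => ?_⟩
    set N := max N1 (4 * (m + 1) * (m + 2) * (m + 2)) with hNdef
    have hNN1 : N1 ≤ N := le_max_left _ _
    have hNC : 4 * (m + 1) * (m + 2) * (m + 2) ≤ N := le_max_right _ _
    have hm : m + 1 ≤ N := by
      refine le_trans ?_ hNC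
      have e : 4 * (m + 1) * (m + 2) * (m + 2) = (m + 1) * (4 * (m + 2) * (m + 2)) := by ring
      rw [e]
      exact Nat.le_mul_of_pos_right _ (by positivity)
    obtain ⟨d, rfl⟩ := Nat.exists_eq_add_of_le (show m + 1 ≤ n by omega)
    have hp := pos d k (by omega) (by omega)
    refine ⟨hp, ?_⟩
    have key := eulF_final m d k N (by exact_mod_cast hNC) (by omega) (by omega)
      (permRises π') (permRises π) hr' hr
    rw [← D_eq_eulF, ← D_eq_eulF] at key
    have keyR : (N : ℝ) * |(D (m + 1) π (m + 1 + d) k : ℝ) - D (m + 1) π' (m + 1 + d) k| ≤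
        4 * (m + 1) * (m + 2) * (m + 2) * D (m + 1) π' (m + 1 + d) k := by exact_mod_cast key
    have hpR : (0 : ℝ) < D (m + 1) π' (m + 1 + d) k := by exact_mod_cast hp
    generalize (D (m + 1) π' (m + 1 + d) k : ℝ) = b at *
    generalize (D (m + 1) π (m + 1 + d) k : ℝ) = a at *
    rw [div_sub_one hpR.ne', abs_div, abs_of_pos hpR, div_lt_iff₀ hpR]
    have hNR : (4 * (m + 1) * (m + 2) * (m + 2) : ℝ) < N * ε := by
      rw [div_lt_iff₀ hε] at hN1
      refine hN1.trans_le ?_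
      gcongr
    have hN0 : (0 : ℝ) < N := by
      have : 0 < N := by omega
      exact_mod_cast this
    have h3 := mul_lt_mul_of_pos_right hNR hpR
    have h4 : (N : ℝ) * |a - b| < N * (ε * b) := by linarith
    exact lt_of_mul_lt_mul_left h4 hN0.le
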